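/- Fix a finite index set $J$, integers $c_i, d_i$ for $i \in J$ with $c_i$ and $d_i$ coprime, set $p_i(t) = c_i t + d_i$ and $\Delta_{i,j} = c_i d_j - c_j d_i$, and assume $\Delta_{i,j} \neq 0$ for $i \neq j$. Fix a partition $J = A \cup B$ and nonzero integers $a, b$, and write $p_{J'}(t) = \prod_{j \in J'} p_j(t)$ for $J' \subseteq J$. Let $p$ be an odd prime dividing neither $a$, nor $b$, nor any $\Delta_{i,j}$ with $i \neq j$. Suppose $x, y, t \in \mathbb{Z}_p$ satisfy $a\,p_A(t)\,x^2 + b\,p_B(t)\,y^2 = 1$ and $i \in J$ satisfies $p \mid p_i(t)$ in $\mathbb{Z}_p$. Then $c_i$ is a unit in $\mathbb{Z}_p$ and, with $\tau_i = -d_i/c_i \in \mathbb{Z}_p$: if $i \notin A$ then $a\,p_A(\tau_i)$ is a square in $\mathbb{Z}_p$, and if $i \in A$ then $b\,p_B(\tau_i)$ is a square in $\mathbb{Z}_p$. -/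

import Mathlib

/-- A `p`-adic integer congruent to the square of a unit modulo an odd prime `p` is a square. -/
theorem PadicInt.isSquare_of_dvd_sub_sq {p : ℕ} [Fact p.Prime] (hp2 : p ≠ 2) {u v : ℤ_[p]}
    (hv : IsUnit v) (h : (p : ℤ_[p]) ∣ v ^ 2 - u) : IsSquare u := by
  have h2 : ‖(2 : ℤ_[p])‖ = 1 := by
    refine le_antisymm (PadicInt.norm_le_one _) (not_lt.mp fun hlt => hp2 ?_)
    have hdvd : (p : ℤ) ∣ 2 := (PadicInt.norm_int_lt_one_iff_dvd 2).mp (by exact_mod_cast hlt)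
    exact (Nat.prime_dvd_prime_iff_eq Fact.out Nat.prime_two).mp (by exact_mod_cast hdvd)
  have hnorm : ‖(Polynomial.X ^ 2 - Polynomial.C u : Polynomial ℤ_[p]).aeval v‖ <
      ‖(Polynomial.X ^ 2 - Polynomial.C u : Polynomial ℤ_[p]).derivative.aeval v‖ ^ 2 := by
    simpa [one_add_one_eq_two, h2, PadicInt.isUnit_iff.mp hv] using (PadicInt.norm_lt_one_iff_dvd _).mpr h
  obtain ⟨z, hz, -⟩ := hensels_lemma hnorm
  refine ⟨z, ?_⟩
  simp only [map_sub, map_pow, Polynomial.aeval_X, Polynomial.aeval_C, Algebra.algebraMap_self,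
    RingHom.id_apply] at hz
  linear_combination -hz

/-- If `u x ^ 2 + w y ^ 2 = 1` in `ℤ_p` with `p` odd and `p ∣ w`, then everything congruent to `u`
modulo `p` is a square. -/
theorem PadicInt.isSquare_of_mul_sq_add_mul_sq_eq_one {p : ℕ} [Fact p.Prime] (hp2 : p ≠ 2)
    {u u' w x y : ℤ_[p]} (h : u * x ^ 2 + w * y ^ 2 = 1) (hw : (p : ℤ_[p]) ∣ w)
    (hu : (p : ℤ_[p]) ∣ u - u') : IsSquare u' := by
  have hx : IsUnit x := by
    by_contra hx
    have hpx := (PadicInt.norm_lt_one_iff_dvd x).mp (PadicInt.not_isUnit_iff.mp hx)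
    refine PadicInt.prime_p.not_dvd_one (h ▸ dvd_add ?_ (hw.mul_right _))
    exact (dvd_pow hpx two_ne_zero).mul_left u
  obtain ⟨v, hxv⟩ := hx.exists_right_inv
  refine PadicInt.isSquare_of_dvd_sub_sq hp2 (IsUnit.of_mul_eq_one_right x hxv) ?_
  obtain ⟨k, hk⟩ := hw
  obtain ⟨l, hl⟩ := hu
  refine ⟨k * y ^ 2 * v ^ 2 + l, ?_⟩
  linear_combination (-v ^ 2) * h + y ^ 2 * v ^ 2 * hk + hl + u * (x * v + 1) * hxv

/-- The value of a product of linear forms modulo `s - t`. -/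
theorem sub_dvd_prod_linear_sub_prod_linear {R ι : Type*} [CommRing R] (S : Finset ι)
    (c d : ι → R) (s t : R) :
    s - t ∣ ∏ j ∈ S, (c j * s + d j) - ∏ j ∈ S, (c j * t + d j) := by
  have h := Polynomial.sub_dvd_eval_sub s t
    (∏ j ∈ S, (Polynomial.C (c j) * Polynomial.X + Polynomial.C (d j)))
  simpa [Polynomial.eval_prod] using h

/-- Triviality of the local invariants of the vertical Brauer classes at good places:
a `ℤ_p`-point on a fibre of `a p_A(t) x² + b p_B(t) y² = 1` meeting the vanishing locus
of `p_i` modulo `p` forces the corresponding coefficient at `τ_i = -d_i / c_i` to be a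
square in `ℤ_p`. -/
theorem stmt_14 (J : Type*) [Fintype J] [DecidableEq J] (c d : J → ℤ)
    (hcop : ∀ i, IsCoprime (c i) (d i))
    (hΔ : ∀ i j, i ≠ j → c i * d j - c j * d i ≠ 0)
    (A : Finset J) (a b : ℤ) (ha : a ≠ 0) (hb : b ≠ 0)
    (p : ℕ) [Fact p.Prime] (hp2 : p ≠ 2)
    (hpa : ¬ (p : ℤ) ∣ a) (hpb : ¬ (p : ℤ) ∣ b)
    (hpΔ : ∀ i j, i ≠ j → ¬ (p : ℤ) ∣ (c i * d j - c j * d i))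
    (x y t : ℤ_[p])
    (hxy : (a : ℤ_[p]) * (∏ j ∈ A, ((c j : ℤ_[p]) * t + (d j : ℤ_[p]))) * x ^ 2 +
           (b : ℤ_[p]) * (∏ j ∈ Aᶜ, ((c j : ℤ_[p]) * t + (d j : ℤ_[p]))) * y ^ 2 = 1)
    (i : J) (hi : (p : ℤ_[p]) ∣ ((c i : ℤ_[p]) * t + (d i : ℤ_[p]))) :
    IsUnit ((c i : ℤ_[p])) ∧
    (letI τ : ℤ_[p] := -(d i : ℤ_[p]) * Ring.inverse (c i : ℤ_[p])
     (i ∉ A → IsSquare ((a : ℤ_[p]) * ∏ j ∈ A, ((c j : ℤ_[p]) * τ + (d j : ℤ_[p])))) ∧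
     (i ∈ A → IsSquare ((b : ℤ_[p]) * ∏ j ∈ Aᶜ, ((c j : ℤ_[p]) * τ + (d j : ℤ_[p]))))) := by
  have hc : IsUnit (c i : ℤ_[p]) := by
    by_contra hc
    have hpc := (PadicInt.norm_lt_one_iff_dvd _).mp (PadicInt.not_isUnit_iff.mp hc)
    have hpd := (dvd_add_right (hpc.mul_right t)).mp hi
    obtain ⟨r, s, hrs⟩ := hcop i
    have hrs' : (r : ℤ_[p]) * c i + s * d i = 1 := by exact_mod_cast hrs
    exact PadicInt.prime_p.not_dvd_one
      (hrs' ▸ dvd_add (hpc.mul_left _) (hpd.mul_left _))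
  refine ⟨hc, ?_⟩
  have hτ : (p : ℤ_[p]) ∣ t - -(d i : ℤ_[p]) * Ring.inverse (c i : ℤ_[p]) := by
    convert hi.mul_left (Ring.inverse (c i : ℤ_[p])) using 1
    linear_combination (-t) * Ring.inverse_mul_cancel _ hc
  have hcongr (e : ℤ_[p]) (S : Finset J) := (hτ.trans (sub_dvd_prod_linear_sub_prod_linear S
    (fun j => (c j : ℤ_[p])) (fun j => (d j : ℤ_[p])) t _)).mul_left e
  simp only [mul_sub] at hcongr
  have hprod (e : ℤ_[p]) {S : Finset J} (hS : i ∈ S) :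
      (p : ℤ_[p]) ∣ e * ∏ j ∈ S, ((c j : ℤ_[p]) * t + (d j : ℤ_[p])) :=
    (hi.trans (Finset.dvd_prod_of_mem
      (fun j => (c j : ℤ_[p]) * t + (d j : ℤ_[p])) hS)).mul_left e
  exact ⟨fun hiA => PadicInt.isSquare_of_mul_sq_add_mul_sq_eq_one hp2 hxy
      (hprod _ (Finset.mem_compl.mpr hiA)) (hcongr _ _),
    fun hiA => PadicInt.isSquare_of_mul_sq_add_mul_sq_eq_one hp2 ((add_comm _ _).trans hxy)
      (hprod _ hiA) (hcongr _ _)⟩
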